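/- arXiv:math/0502142 — 2 statements merged into one kernel-verified Lean document; each statement's English description precedes it below -/
import Mathlib

section
/- Assume K_* > 0 and f satisfies (f1)–(f2). If ∫₀¹ g(s) ds = +∞, then problem (P_{λ,μ}) has no classical solution, for any λ > 0 and μ > 0. -/
open Set MeasureTheory Filter Topology

/-- The Laplace operator: sum of second partial derivatives. -/
noncomputable def lap {N : ℕ} (u : EuclideanSpace ℝ (Fin N) → ℝ)
    (x : EuclideanSpace ℝ (Fin N)) : ℝ :=
  ∑ i : Fin N,
    fderiv ℝ (fun y => fderiv ℝ u y (EuclideanSpace.single i 1)) x (EuclideanSpace.single i 1)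

/-- Locally Hölder continuous (with some exponent `r ∈ (0,1]`) on a set. -/
def LocHolderOn {X Y : Type*} [PseudoMetricSpace X] [PseudoMetricSpace Y]
    (f : X → Y) (s : Set X) : Prop :=
  ∃ r : NNReal, 0 < r ∧ r ≤ 1 ∧
    ∀ x ∈ s, ∃ t ∈ nhdsWithin x s, ∃ C : NNReal, HolderOnWith C r f t
/-- A classical solution of `−Δu + K(x) g(u) = λ f(x,u) + μ h(x)` in `Ω`,
`u > 0` in `Ω`, `u = 0` on `∂Ω`. -/
def IsSolK {N : ℕ} (Ω : Set (EuclideanSpace ℝ (Fin N)))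
    (K h : EuclideanSpace ℝ (Fin N) → ℝ) (f : EuclideanSpace ℝ (Fin N) → ℝ → ℝ)
    (g : ℝ → ℝ) (lam mu : ℝ) (u : EuclideanSpace ℝ (Fin N) → ℝ) : Prop :=
  ContDiffOn ℝ 2 u Ω ∧ ContinuousOn u (closure Ω) ∧
  (∀ x ∈ Ω, 0 < u x) ∧ (∀ x ∈ frontier Ω, u x = 0) ∧
  (∀ x ∈ Ω, -(lap u x) + K x * g (u x) = lam * f x (u x) + mu * h x)

/-- A solution in the class `E = {u ∈ C²(Ω) ∩ C(Ω̄) : Δu ∈ L¹(Ω)}`. -/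
def IsSolKE {N : ℕ} (Ω : Set (EuclideanSpace ℝ (Fin N)))
    (K h : EuclideanSpace ℝ (Fin N) → ℝ) (f : EuclideanSpace ℝ (Fin N) → ℝ → ℝ)
    (g : ℝ → ℝ) (lam mu : ℝ) (u : EuclideanSpace ℝ (Fin N) → ℝ) : Prop :=
  IsSolK Ω K h f g lam mu u ∧ IntegrableOn (lap u) Ω volume


/-- Integration by parts for `θ(u) p`, supported in a compact subset `T` of `Ω`. -/
lemma aux_parts {N : ℕ} {Ω T : Set (EuclideanSpace ℝ (Fin N))} (hΩ : IsOpen Ω)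
    (hT : IsCompact T) (hTΩ : T ⊆ Ω) {u p : EuclideanSpace ℝ (Fin N) → ℝ}
    (hu : ContDiffOn ℝ 1 u Ω) (hp : ContDiffOn ℝ 1 p Ω) {θ η : ℝ → ℝ}
    (hθ : ∀ s, HasDerivAt θ (η s) s) (hη : Continuous η)
    (hz : ∀ x ∈ Ω, x ∉ T → θ (u x) = 0) (v : EuclideanSpace ℝ (Fin N)) :
    IntegrableOn (fun x => η (u x) * fderiv ℝ u x v * p x + θ (u x) * fderiv ℝ p x v) T volume ∧
    ∫ x in T, (η (u x) * fderiv ℝ u x v * p x + θ (u x) * fderiv ℝ p x v) = 0 := by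
  have hθc : Continuous θ := continuous_iff_continuousAt.2 fun s => (hθ s).continuousAt
  have cu : ContinuousOn u T := hu.continuousOn.mono hTΩ
  have cp : ContinuousOn p T := hp.continuousOn.mono hTΩ
  have cdu : ContinuousOn (fun x => fderiv ℝ u x v) T :=
    ((hu.continuousOn_fderiv_of_isOpen hΩ le_rfl).mono hTΩ).clm_apply continuousOn_const
  have cdp : ContinuousOn (fun x => fderiv ℝ p x v) T :=
    ((hp.continuousOn_fderiv_of_isOpen hΩ le_rfl).mono hTΩ).clm_apply continuousOn_const
  have cF : ContinuousOn
      (fun x => η (u x) * fderiv ℝ u x v * p x + θ (u x) * fderiv ℝ p x v) T :=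
    (((hη.comp_continuousOn cu).mul cdu).mul cp).add ((hθc.comp_continuousOn cu).mul cdp)
  have iF := cF.integrableOn_compact (μ := volume) hT
  refine ⟨iF, ?_⟩
  have iG : IntegrableOn (fun x => θ (u x) * p x) T volume :=
    ((hθc.comp_continuousOn cu).mul cp).integrableOn_compact hT
  have hGT : ∀ x, x ∉ T → T.indicator (fun x => θ (u x) * p x) x = 0 :=
    fun x hx => indicator_of_notMem hx _
  have hder : ∀ x, HasLineDerivAt ℝ (T.indicator (fun x => θ (u x) * p x))
      (T.indicator
        (fun x => η (u x) * fderiv ℝ u x v * p x + θ (u x) * fderiv ℝ p x v) x) x v := by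
    intro x
    by_cases hx : x ∈ T
    · have hxΩ := hΩ.mem_nhds (hTΩ hx)
      have d1 : HasFDerivAt u (fderiv ℝ u x) x :=
        ((hu.contDiffAt hxΩ).differentiableAt one_ne_zero).hasFDerivAt
      have d2 : HasFDerivAt p (fderiv ℝ p x) x :=
        ((hp.contDiffAt hxΩ).differentiableAt one_ne_zero).hasFDerivAt
      have d3 : HasFDerivAt (fun y => θ (u y)) (η (u x) • fderiv ℝ u x) x :=
        (hθ (u x)).comp_hasFDerivAt x d1
      have d4 := (d3.mul d2)
      have e : T.indicator (fun x => θ (u x) * p x) =ᶠ[𝓝 x] fun y => θ (u y) * p y := by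
        filter_upwards [hxΩ] with y hy
        by_cases hyT : y ∈ T
        · rw [indicator_of_mem hyT]
        · rw [indicator_of_notMem hyT, hz y hy hyT, zero_mul]
      have d5 := (d4.congr_of_eventuallyEq e).hasLineDerivAt v
      rw [indicator_of_mem hx]
      have hE : η (u x) * fderiv ℝ u x v * p x + θ (u x) * fderiv ℝ p x v =
          (θ (u x) • fderiv ℝ p x + p x • (η (u x) • fderiv ℝ u x)) v := by
        simp
        ring
      rw [hE]
      exact d5
    · rw [indicator_of_notMem hx]
      have e : T.indicator (fun x => θ (u x) * p x) =ᶠ[𝓝 x] fun _ => 0 := by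
        filter_upwards [hT.isClosed.isOpen_compl.mem_nhds hx] with y hy
        exact indicator_of_notMem hy _
      have := ((hasFDerivAt_const (𝕜 := ℝ) (0:ℝ) x).congr_of_eventuallyEq e).hasLineDerivAt v
      simpa using this
  have key := integral_bilinear_hasLineDerivAt_right_eq_neg_left_of_integrable
    (μ := (volume : Measure (EuclideanSpace ℝ (Fin N)))) (f := fun _ => (1:ℝ))
    (f' := fun _ => (0:ℝ)) (v := v) (B := ContinuousLinearMap.mul ℝ ℝ)
    (g := T.indicator (fun x => θ (u x) * p x))
    (g' := T.indicator
        (fun x => η (u x) * fderiv ℝ u x v * p x + θ (u x) * fderiv ℝ p x v))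
    (by simp) (by simpa using (integrable_indicator_iff hT.measurableSet).2 iF)
    (by simpa using (integrable_indicator_iff hT.measurableSet).2 iG)
    (fun x _ => by simpa using (hasFDerivAt_const (1:ℝ) x).hasLineDerivAt v)
    (fun x _ => hder x)
  simp only [ContinuousLinearMap.mul_apply', one_mul, zero_mul, integral_zero, neg_zero] at key
  rwa [integral_indicator hT.measurableSet] at key

lemma aux_energy {N : ℕ} {Ω T : Set (EuclideanSpace ℝ (Fin N))} (hΩ : IsOpen Ω)
    (hT : IsCompact T) (hTΩ : T ⊆ Ω) {u : EuclideanSpace ℝ (Fin N) → ℝ}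
    (hu : ContDiffOn ℝ 2 u Ω) {θ η : ℝ → ℝ}
    (hθ : ∀ s, HasDerivAt θ (η s) s) (hη : Continuous η)
    (hz : ∀ x ∈ Ω, x ∉ T → θ (u x) = 0) :
    IntegrableOn (fun x => η (u x) * ∑ i, (fderiv ℝ u x (EuclideanSpace.single i 1)) ^ 2
      + θ (u x) * lap u x) T volume ∧
    ∫ x in T, (η (u x) * ∑ i, (fderiv ℝ u x (EuclideanSpace.single i 1)) ^ 2
      + θ (u x) * lap u x) = 0 := by
  have hu1 : ContDiffOn ℝ 1 u Ω := hu.of_le (by norm_num)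
  have hp : ∀ i : Fin N, ContDiffOn ℝ 1
      (fun y => fderiv ℝ u y (EuclideanSpace.single i 1)) Ω := fun i =>
    (hu.fderiv_of_isOpen hΩ (by norm_num)).clm_apply contDiffOn_const
  have h := fun i : Fin N =>
    aux_parts hΩ hT hTΩ hu1 (hp i) hθ hη hz (EuclideanSpace.single i 1)
  have e : (fun x => η (u x) * ∑ i, (fderiv ℝ u x (EuclideanSpace.single i 1)) ^ 2
      + θ (u x) * lap u x) = fun x => ∑ i : Fin N, (η (u x) *
        fderiv ℝ u x (EuclideanSpace.single i 1) * fderiv ℝ u x (EuclideanSpace.single i 1)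
        + θ (u x) * fderiv ℝ (fun y => fderiv ℝ u y (EuclideanSpace.single i 1)) x
          (EuclideanSpace.single i 1)) := by
    funext x
    rw [lap, Finset.mul_sum, Finset.mul_sum, ← Finset.sum_add_distrib]
    refine Finset.sum_congr rfl fun i _ => ?_
    ring
  rw [e]
  refine ⟨integrable_finsetSum _ fun i _ => (h i).1, ?_⟩
  rw [integral_finsetSum _ fun i _ => (h i).1]
  exact Finset.sum_eq_zero fun i _ => (h i).2

lemma aux_radial {N : ℕ} {Ω T : Set (EuclideanSpace ℝ (Fin N))} (hΩ : IsOpen Ω)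
    (hT : IsCompact T) (hTΩ : T ⊆ Ω) {u : EuclideanSpace ℝ (Fin N) → ℝ}
    (hu : ContDiffOn ℝ 2 u Ω) {θ η : ℝ → ℝ}
    (hθ : ∀ s, HasDerivAt θ (η s) s) (hη : Continuous η)
    (hz : ∀ x ∈ Ω, x ∉ T → θ (u x) = 0) :
    IntegrableOn (fun x => η (u x) * ∑ i, fderiv ℝ u x (EuclideanSpace.single i 1) * x i
      + θ (u x) * N) T volume ∧
    ∫ x in T, (η (u x) * ∑ i, fderiv ℝ u x (EuclideanSpace.single i 1) * x i
      + θ (u x) * N) = 0 := by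
  have hu1 : ContDiffOn ℝ 1 u Ω := hu.of_le (by norm_num)
  have hp : ∀ i : Fin N, ContDiffOn ℝ 1
      (fun y : EuclideanSpace ℝ (Fin N) => y i) Ω := fun i =>
    (EuclideanSpace.proj (𝕜 := ℝ) i : EuclideanSpace ℝ (Fin N) →L[ℝ] ℝ).contDiff.contDiffOn
  have hd : ∀ (i : Fin N) (x : EuclideanSpace ℝ (Fin N)),
      fderiv ℝ (fun y : EuclideanSpace ℝ (Fin N) => y i) x (EuclideanSpace.single i 1) = 1 := by
    intro i x
    have : fderiv ℝ (fun y : EuclideanSpace ℝ (Fin N) => y i) x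
        = (EuclideanSpace.proj (𝕜 := ℝ) i : EuclideanSpace ℝ (Fin N) →L[ℝ] ℝ) :=
      (EuclideanSpace.proj (𝕜 := ℝ) i : EuclideanSpace ℝ (Fin N) →L[ℝ] ℝ).fderiv
    rw [this]
    simp
  have h := fun i : Fin N =>
    aux_parts hΩ hT hTΩ hu1 (hp i) hθ hη hz (EuclideanSpace.single i 1)
  simp only [hd] at h
  have e : (fun x => η (u x) * ∑ i, fderiv ℝ u x (EuclideanSpace.single i 1) * x i
      + θ (u x) * N) = fun x => ∑ i : Fin N, (η (u x) *
        fderiv ℝ u x (EuclideanSpace.single i 1) * x i + θ (u x) * 1) := by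
    funext x
    rw [Finset.sum_add_distrib, Finset.mul_sum]
    simp only [Finset.sum_const, Finset.card_univ, Fintype.card_fin, nsmul_eq_mul, mul_one,
      mul_assoc, mul_comm (N : ℝ)]
  rw [e]
  refine ⟨integrable_finsetSum _ fun i _ => (h i).1, ?_⟩
  rw [integral_finsetSum _ fun i _ => (h i).1]
  exact Finset.sum_eq_zero fun i _ => (h i).2

/-- Upper bound for `∫ θ(u) G` when `-Δu ≤ M - k G`. -/
lemma aux_upper {N : ℕ} {Ω T : Set (EuclideanSpace ℝ (Fin N))} (hΩ : IsOpen Ω)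
    (hT : IsCompact T) (hTΩ : T ⊆ Ω) {u : EuclideanSpace ℝ (Fin N) → ℝ}
    (hu : ContDiffOn ℝ 2 u Ω) {θ η : ℝ → ℝ}
    (hθ : ∀ s, HasDerivAt θ (η s) s) (hη : Continuous η)
    (hz : ∀ x ∈ Ω, x ∉ T → θ (u x) = 0) (hη0 : ∀ s, 0 ≤ η s) (hθ0 : ∀ s, 0 ≤ θ s)
    (hθ1 : ∀ s, θ s ≤ 1) {g : ℝ → ℝ} {k M V : ℝ} (hk : 0 < k) (hM : 0 ≤ M)
    (hV : volume.real T ≤ V) (hg : ContinuousOn (fun x => g (u x)) T)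
    (hl : ∀ x ∈ T, -lap u x ≤ M - k * g (u x)) :
    ∫ x in T, g (u x) * θ (u x) ≤ M * V / k := by
  obtain ⟨i1, e1⟩ := aux_energy hΩ hT hTΩ hu hθ hη hz
  have hθc : Continuous θ := continuous_iff_continuousAt.2 fun s => (hθ s).continuousAt
  have cu : ContinuousOn u T := hu.continuousOn.mono hTΩ
  have i2 : IntegrableOn (fun x => g (u x) * θ (u x)) T volume :=
    (hg.mul (hθc.comp_continuousOn cu)).integrableOn_compact hT
  have hfin : volume T ≠ ⊤ := hT.measure_lt_top.ne
  have i3 : IntegrableOn (fun _ : EuclideanSpace ℝ (Fin N) => M) T volume :=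
    integrableOn_const hfin
  have hmono := setIntegral_mono_on (i2.const_mul k) (i1.add i3) hT.measurableSet
    (fun x hx => by
      have h1 := mul_le_mul_of_nonneg_left (hl x hx) (hθ0 (u x))
      have h2 : 0 ≤ η (u x) * ∑ i, (fderiv ℝ u x (EuclideanSpace.single i 1)) ^ 2 :=
        mul_nonneg (hη0 _) (Finset.sum_nonneg fun i _ => sq_nonneg _)
      have h3 := mul_le_mul_of_nonneg_right (hθ1 (u x)) hM
      show k * (g (u x) * θ (u x)) ≤ (η (u x) * _ + θ (u x) * lap u x) + M
      linarith)
  rw [integral_const_mul] at hmono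
  rw [integral_add' i1 i3, e1, setIntegral_const, smul_eq_mul, zero_add] at hmono
  rw [le_div_iff₀ hk]
  have := mul_le_mul_of_nonneg_right hV hM
  linarith

/-- `∫ θ(u) ≤ C ∫ η(u)`. -/
lemma aux_lower {N : ℕ} (hN : 1 ≤ N) {Ω T : Set (EuclideanSpace ℝ (Fin N))} (hΩ : IsOpen Ω)
    (hT : IsCompact T) (hTΩ : T ⊆ Ω) {u : EuclideanSpace ℝ (Fin N) → ℝ}
    (hu : ContDiffOn ℝ 2 u Ω) {θ η : ℝ → ℝ}
    (hθ : ∀ s, HasDerivAt θ (η s) s) (hη : Continuous η)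
    (hz : ∀ x ∈ Ω, x ∉ T → θ (u x) = 0) (hη0 : ∀ s, 0 ≤ η s) (hθ0 : ∀ s, 0 ≤ θ s)
    {M R : ℝ} (hM : 0 < M) (hR : ∀ x ∈ T, ‖x‖ ≤ R)
    (hl : ∀ x ∈ T, -lap u x ≤ M) :
    ∫ x in T, θ (u x) ≤ M * R ^ 2 * ∫ x in T, η (u x) := by
  obtain ⟨i1, e1⟩ := aux_energy hΩ hT hTΩ hu hθ hη hz
  obtain ⟨i2, e2⟩ := aux_radial hΩ hT hTΩ hu hθ hη hz
  have hθc : Continuous θ := continuous_iff_continuousAt.2 fun s => (hθ s).continuousAt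
  have cu : ContinuousOn u T := hu.continuousOn.mono hTΩ
  have i3 : IntegrableOn (fun x => θ (u x)) T volume :=
    (hθc.comp_continuousOn cu).integrableOn_compact hT
  have i4 : IntegrableOn (fun x => η (u x)) T volume :=
    (hη.comp_continuousOn cu).integrableOn_compact hT
  have hN' : (1:ℝ) ≤ N := by exact_mod_cast hN
  have i5 := (i2.const_mul 2).add (i1.const_mul (1 / M))
  have hmono := setIntegral_mono_on i3 (i5.add (i4.const_mul (M * R ^ 2))) hT.measurableSet
    (fun x hx => by
      have h1 := mul_le_mul_of_nonneg_left (hl x hx) (hθ0 (u x))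
      have hx2 : ∑ i, (x i) ^ 2 ≤ R ^ 2 := by
        have := EuclideanSpace.real_norm_sq_eq x
        rw [← this]
        exact pow_le_pow_left₀ (norm_nonneg _) (hR x hx) 2
      have h2 : -(2 * ∑ i, fderiv ℝ u x (EuclideanSpace.single i 1) * x i) ≤
          1 / M * ∑ i, (fderiv ℝ u x (EuclideanSpace.single i 1)) ^ 2 + M * R ^ 2 := by
        have : -(2 * ∑ i, fderiv ℝ u x (EuclideanSpace.single i 1) * x i) ≤
          1 / M * ∑ i, (fderiv ℝ u x (EuclideanSpace.single i 1)) ^ 2 + M * ∑ i, (x i) ^ 2 := by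
          rw [Finset.mul_sum, Finset.mul_sum, Finset.mul_sum, ← Finset.sum_add_distrib,
            ← Finset.sum_neg_distrib]
          refine Finset.sum_le_sum fun i _ => ?_
          have h3 : 0 ≤ 1 / M * (fderiv ℝ u x (EuclideanSpace.single i 1) + M * x i) ^ 2 := by
            positivity
          have h4 : 1 / M * (fderiv ℝ u x (EuclideanSpace.single i 1) + M * x i) ^ 2 =
            1 / M * fderiv ℝ u x (EuclideanSpace.single i 1) ^ 2 + M * x i ^ 2 +
              2 * (fderiv ℝ u x (EuclideanSpace.single i 1) * x i) := by
            field_simp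
            ring
          linarith
        have := mul_le_mul_of_nonneg_left hx2 hM.le
        linarith
      have h3 := mul_le_mul_of_nonneg_left h2 (hη0 (u x))
      have h4 := mul_le_mul_of_nonneg_left h1 (one_div_pos.2 hM).le
      have h5 : 1 / M * (θ (u x) * M) = θ (u x) := by field_simp
      rw [h5] at h4
      have h6 := mul_le_mul_of_nonneg_left hN' (hθ0 (u x))
      show θ (u x) ≤ 2 * (η (u x) * _ + θ (u x) * N) + 1 / M * (η (u x) * _ + θ (u x) * lap u x)
        + M * R ^ 2 * η (u x)
      linarith)
  rw [integral_add' i5 (i4.const_mul _), integral_add' (i2.const_mul 2) (i1.const_mul _),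
    integral_const_mul, integral_const_mul, integral_const_mul, e1, e2] at hmono
  simpa using hmono

/-- If `K_* > 0`, `f` satisfies (f1)–(f2), and `∫₀¹ g(s) ds = +∞`,
then problem `(P_{λ,μ})` has no classical solution, for any `λ, μ > 0`. -/
theorem no_solution_of_strong_singularity
    {N : ℕ} (hN : 2 ≤ N) (Ω : Set (EuclideanSpace ℝ (Fin N)))
    (hΩopen : IsOpen Ω) (hΩbdd : Bornology.IsBounded Ω) (hΩne : Ω.Nonempty)
    (K h : EuclideanSpace ℝ (Fin N) → ℝ)
    (hK_holder : ∃ C r : NNReal, 0 < r ∧ r ≤ 1 ∧ HolderOnWith C r K (closure Ω))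
    (hh_holder : ∃ C r : NNReal, 0 < r ∧ r ≤ 1 ∧ HolderOnWith C r h (closure Ω))
    (hh_pos : ∀ x ∈ Ω, 0 < h x)
    (f : EuclideanSpace ℝ (Fin N) → ℝ → ℝ)
    (hf_holder : LocHolderOn (fun z : EuclideanSpace ℝ (Fin N) × ℝ => f z.1 z.2)
      ((closure Ω) ×ˢ Ici (0:ℝ)))
    (hf_nonneg : ∀ x ∈ closure Ω, ∀ s : ℝ, 0 ≤ s → 0 ≤ f x s)
    (hf_pos : ∀ x ∈ closure Ω, ∀ s : ℝ, 0 < s → 0 < f x s)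
    (hf_mono : ∀ x ∈ closure Ω, ∀ s t : ℝ, 0 ≤ s → s ≤ t → f x s ≤ f x t)
    (hf1 : ∀ x ∈ closure Ω, ∀ s t : ℝ, 0 < s → s ≤ t → f x t / t ≤ f x s / s)
    (hf2zero : ∀ M : ℝ, ∃ δ > (0:ℝ), ∀ x ∈ closure Ω, ∀ s : ℝ, 0 < s → s < δ → M ≤ f x s / s)
    (hf2inf : ∀ ε > (0:ℝ), ∃ S > (0:ℝ), ∀ x ∈ closure Ω, ∀ s : ℝ, S ≤ s → f x s / s ≤ ε)
    (g : ℝ → ℝ)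
    (hg_holder : LocHolderOn g (Ioi (0:ℝ)))
    (hg_nonneg : ∀ s : ℝ, 0 < s → 0 ≤ g s)
    (hg_anti : ∀ s t : ℝ, 0 < s → s ≤ t → g t ≤ g s)
    (hKstar : ∀ x ∈ closure Ω, 0 < K x)
    (hg_int : ∫⁻ s in Ioo (0:ℝ) 1, ENNReal.ofReal (g s) = ⊤)
    (lam mu : ℝ) (hlam : 0 < lam) (hmu : 0 < mu) :
    ¬ ∃ u : EuclideanSpace ℝ (Fin N) → ℝ, IsSolK Ω K h f g lam mu u := by
  rintro ⟨u, hu2, huc, hupos, hubd, heq⟩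
  have hcomp : IsCompact (closure Ω) := hΩbdd.isCompact_closure
  obtain ⟨x0, hx0⟩ := hΩne
  have hsub : Ω ⊆ closure Ω := subset_closure
  -- constants
  obtain ⟨k, hk, hkK⟩ : ∃ k : ℝ, 0 < k ∧ ∀ x ∈ closure Ω, k ≤ K x := by
    obtain ⟨C, r, hr, -, hC⟩ := hK_holder
    obtain ⟨y, hy, hmin⟩ := hcomp.exists_isMinOn ⟨x0, hsub hx0⟩ (hC.continuousOn hr)
    exact ⟨K y, hKstar y hy, fun x hx => hmin hx⟩
  obtain ⟨Ch, hCh⟩ : ∃ C : ℝ, ∀ x ∈ closure Ω, ‖h x‖ ≤ C := by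
    obtain ⟨C, r, hr, -, hC⟩ := hh_holder
    exact hcomp.exists_bound_of_continuousOn (hC.continuousOn hr)
  obtain ⟨Cu, hCu⟩ := hcomp.exists_bound_of_continuousOn huc
  obtain ⟨S, hS, hfS⟩ := hf2inf 1 one_pos
  obtain ⟨R, hR⟩ := isBounded_iff_forall_norm_le.1 hcomp.isBounded
  have hCh0 : 0 ≤ Ch := (norm_nonneg _).trans (hCh x0 (hsub hx0))
  obtain ⟨M, hMdef⟩ : ∃ M, M = lam * max Cu S + mu * Ch + 1 := ⟨_, rfl⟩
  have hM : 0 < M := by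
    have : 0 < max Cu S := lt_max_of_lt_right hS
    rw [hMdef]; positivity
  have hl : ∀ x ∈ Ω, -lap u x ≤ M - k * g (u x) := by
    intro x hx
    have hxc := hsub hx
    have h1 : f x (u x) ≤ max Cu S := by
      have ha : u x ≤ max Cu S :=
        le_max_of_le_left ((le_abs_self _).trans (hCu x hxc))
      have hb : 0 < max Cu S := lt_max_of_lt_right hS
      have hc := hfS x hxc (max Cu S) (le_max_right _ _)
      rw [div_le_one hb] at hc
      exact (hf_mono x hxc _ _ (hupos x hx).le ha).trans hc
    have h2 : h x ≤ Ch := (le_abs_self _).trans (hCh x hxc)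
    have h3 := mul_le_mul_of_nonneg_right (hkK x hxc) (hg_nonneg _ (hupos x hx))
    have h4 := mul_le_mul_of_nonneg_left h1 hlam.le
    have h5 := mul_le_mul_of_nonneg_left h2 hmu.le
    have := heq x hx
    linarith
  have gcont : ContinuousOn g (Ioi 0) := by
    obtain ⟨r, hr, -, H⟩ := hg_holder
    intro s hs
    obtain ⟨t, ht, C, hC⟩ := H s hs
    exact ((hC.continuousOn hr) s (mem_of_mem_nhdsWithin hs ht)).mono_of_mem_nhdsWithin ht
  obtain ⟨t0, ht0def⟩ : ∃ t0, t0 = u x0 / 2 := ⟨_, rfl⟩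
  have hux0 := hupos x0 hx0
  have ht0 : 0 < t0 := by rw [ht0def]; positivity
  obtain ⟨W, hWdef⟩ : ∃ W, W = Ω ∩ u ⁻¹' Ioi t0 := ⟨_, rfl⟩
  have hWo : IsOpen W := by
    rw [hWdef]; exact hu2.continuousOn.isOpen_inter_preimage hΩopen isOpen_Ioi
  have hWΩ : W ⊆ Ω := by rw [hWdef]; exact inter_subset_left
  have hWfin : volume W ≠ ⊤ :=
    ((measure_mono (hWΩ.trans hsub)).trans_lt hcomp.measure_lt_top).ne
  have hw : 0 < volume.real W := by
    have hne : W.Nonempty := ⟨x0, by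
      rw [hWdef]; exact ⟨hx0, by simp only [mem_preimage, mem_Ioi]; linarith⟩⟩
    exact ENNReal.toReal_pos (hWo.measure_pos volume hne).ne' hWfin
  have claim : ∀ ε : ℝ, 0 < ε → 2 * ε < t0 → ∫ s in Ioc (2 * ε) t0, g s ≤
      M * R ^ 2 * (M * volume.real (closure Ω) / k) / volume.real W := by
    intro ε hε hεt
    obtain ⟨T, hTdef⟩ : ∃ T, T = closure Ω ∩ u ⁻¹' Ici ε := ⟨_, rfl⟩
    have hTc : T ⊆ closure Ω := by rw [hTdef]; exact inter_subset_left
    have hT : IsCompact T := by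
      refine hcomp.of_isClosed_subset ?_ hTc
      rw [hTdef]
      exact huc.preimage_isClosed_of_isClosed hcomp.isClosed isClosed_Ici
    have hTε : ∀ x ∈ T, ε ≤ u x := by
      intro x hx; rw [hTdef] at hx; exact hx.2
    have hTΩ : T ⊆ Ω := by
      intro x hx
      by_contra hxn
      have : x ∈ frontier Ω := by
        rw [hΩopen.frontier_eq]; exact ⟨hTc hx, hxn⟩
      have h1 := hubd x this
      have h2 := hTε x hx
      linarith
    have hTn : ∀ x ∈ Ω, x ∉ T → u x ≤ ε := by
      intro x hx hxn
      by_contra hcon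
      exact hxn (by rw [hTdef]; exact ⟨hsub hx, (not_le.1 hcon).le⟩)
    obtain ⟨χ, hχdef⟩ : ∃ χ : ℝ → ℝ, χ = fun s => Real.smoothTransition (s / ε - 1) := ⟨_, rfl⟩
    have hχ0 : ∀ s, s ≤ ε → χ s = 0 := by
      intro s hs
      rw [hχdef]
      refine Real.smoothTransition.zero_of_nonpos ?_
      have := (div_le_one hε).2 hs
      linarith
    have hχ1 : ∀ s, 2 * ε ≤ s → χ s = 1 := by
      intro s hs
      rw [hχdef]
      refine Real.smoothTransition.one_of_one_le ?_
      have := (le_div_iff₀ hε).2 hs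
      linarith
    have hχn : ∀ s, 0 ≤ χ s := fun s => by rw [hχdef]; exact Real.smoothTransition.nonneg _
    have hχl : ∀ s, χ s ≤ 1 := fun s => by rw [hχdef]; exact Real.smoothTransition.le_one _
    have hχc : ContDiff ℝ 1 χ := by
      rw [hχdef]
      exact Real.smoothTransition.contDiff.comp ((contDiff_id.div_const ε).sub contDiff_const)
    have hχm : Monotone χ := by
      rw [hχdef]
      intro a b hab
      refine Real.smoothTransition.monotone ?_
      have := div_le_div_of_nonneg_right hab hε.le
      linarith
    have hχd : ∀ s, HasDerivAt χ (deriv χ s) s := fun s =>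
      (hχc.differentiable one_ne_zero s).hasDerivAt
    have hgT : ContinuousOn (fun x => g (u x)) T :=
      gcont.comp (huc.mono hTc) fun x hx => hε.trans_le (hTε x hx)
    have hup := aux_upper hΩopen hT hTΩ hu2 hχd (hχc.continuous_deriv le_rfl)
      (fun x hx hxn => hχ0 _ (hTn x hx hxn)) (fun s => hχm.deriv_nonneg) hχn hχl hk hM.le
      (measureReal_mono hTc hcomp.measure_lt_top.ne) hgT (fun x hx => hl x (hTΩ hx))
    -- the second test function
    obtain ⟨η, hηdef⟩ : ∃ η : ℝ → ℝ, η = fun s => g s * χ s := ⟨_, rfl⟩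
    have hηv : ∀ s, η s = g s * χ s := fun s => by rw [hηdef]
    have hη0 : ∀ s, s ≤ ε → η s = 0 := fun s hs => by rw [hηv, hχ0 s hs, mul_zero]
    have hηn : ∀ s, 0 ≤ η s := by
      intro s
      rcases le_or_gt s ε with hs | hs
      · exact (hη0 s hs).ge
      · rw [hηv]; exact mul_nonneg (hg_nonneg s (hε.trans hs)) (hχn s)
    have hηc : Continuous η := by
      refine continuous_iff_continuousAt.2 fun s => ?_
      rcases lt_or_ge s ε with hs | hs
      · have : η =ᶠ[𝓝 s] fun _ => 0 := by
          filter_upwards [Iio_mem_nhds hs] with y hy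
          exact hη0 y (le_of_lt hy)
        exact continuousAt_const.congr this.symm
      · rw [hηdef]
        exact (gcont.continuousAt (Ioi_mem_nhds (hε.trans_le hs))).mul hχc.continuous.continuousAt
    obtain ⟨θ, hθdef⟩ : ∃ θ : ℝ → ℝ, θ = fun s => ∫ t in (0:ℝ)..s, η t := ⟨_, rfl⟩
    have hθv : ∀ s, θ s = ∫ t in (0:ℝ)..s, η t := fun s => by rw [hθdef]
    have hθd : ∀ s, HasDerivAt θ (η s) s := by
      intro s
      rw [hθdef]
      exact (hηc.integral_hasStrictDerivAt 0 s).hasDerivAt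
    have hθm : Monotone θ := monotone_of_deriv_nonneg (fun s => (hθd s).differentiableAt)
      (fun s => by rw [(hθd s).deriv]; exact hηn s)
    have hθ0 : ∀ s, s ≤ ε → θ s = 0 := by
      intro s hs
      rw [hθv]
      refine intervalIntegral.integral_zero_ae (Eventually.of_forall fun t ht => hη0 t ?_)
      rw [mem_uIoc] at ht
      rcases ht with ht | ht
      · exact ht.2.trans hs
      · exact ht.2.trans hε.le
    have hθn : ∀ s, 0 ≤ θ s := by
      intro s
      rcases le_or_gt s ε with hs | hs
      · exact (hθ0 s hs).ge
      · rw [← hθ0 ε le_rfl]; exact hθm hs.le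
    have hlow := aux_lower (by omega) hΩopen hT hTΩ hu2 hθd hηc
      (fun x hx hxn => hθ0 _ (hTn x hx hxn)) hηn hθn hM (fun x hx => hR x (hTc hx))
      (fun x hx => (hl x (hTΩ hx)).trans (by
        have := mul_nonneg hk.le (hg_nonneg _ (hupos x (hTΩ hx)))
        linarith))
    simp only [hηv] at hlow
    have hWT : W ⊆ T := by
      intro x hx
      rw [hWdef] at hx
      rw [hTdef]
      refine ⟨hsub hx.1, ?_⟩
      have : t0 < u x := hx.2
      simp only [mem_preimage, mem_Ici]
      linarith
    have hθT : IntegrableOn (fun x => θ (u x)) T volume :=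
      ((continuous_iff_continuousAt.2 fun s => (hθd s).continuousAt).comp_continuousOn
        (huc.mono hTc)).integrableOn_compact hT
    have hbelow : volume.real W * θ t0 ≤ ∫ x in T, θ (u x) := by
      have h1 : ∫ x in W, θ t0 ≤ ∫ x in W, θ (u x) := by
        refine setIntegral_mono_on (integrableOn_const hWfin) (hθT.mono_set hWT)
          hWo.measurableSet fun x hx => hθm ?_
        rw [hWdef] at hx
        exact le_of_lt hx.2
      have h2 : ∫ x in W, θ (u x) ≤ ∫ x in T, θ (u x) :=
        setIntegral_mono_set hθT (Eventually.of_forall fun x => hθn _)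
          (Eventually.of_forall hWT)
      rw [setIntegral_const, smul_eq_mul] at h1
      exact h1.trans h2
    have hint : ∫ s in Ioc (2 * ε) t0, g s ≤ θ t0 := by
      have h1 : θ t0 - θ (2 * ε) = ∫ t in (2 * ε)..t0, η t := by
        rw [hθv, hθv]
        exact intervalIntegral.integral_interval_sub_left (hηc.intervalIntegrable _ _)
          (hηc.intervalIntegrable _ _)
      rw [intervalIntegral.integral_of_le hεt.le] at h1
      have h2 : ∫ t in Ioc (2 * ε) t0, η t = ∫ s in Ioc (2 * ε) t0, g s :=
        setIntegral_congr_fun measurableSet_Ioc fun s hs => by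
          simp only [hηv]; rw [hχ1 s hs.1.le, mul_one]
      have := hθn (2 * ε)
      linarith
    rw [le_div_iff₀ hw]
    have h1 := mul_le_mul_of_nonneg_right hint hw.le
    have h2 := mul_le_mul_of_nonneg_left hup (show 0 ≤ M * R ^ 2 by positivity)
    linarith
  -- conclusion
  have hloc : ∀ a b : ℝ, 0 < a → IntegrableOn g (Ioc a b) := by
    intro a b ha
    exact ((gcont.mono fun s hs => ha.trans_le hs.1).integrableOn_compact
      isCompact_Icc).mono_set Ioc_subset_Icc_self
  have hI : IntegrableOn g (Ioc 0 t0) := by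
    refine integrableOn_Ioc_of_intervalIntegral_norm_bounded_left
      (l := atTop) (a := fun n : ℕ => 2 * (1 / ((n:ℝ) + 1)))
      (I := M * R ^ 2 * (M * volume.real (closure Ω) / k) / volume.real W)
      (fun n => hloc _ _ (by positivity)) ?_ ?_
    · simpa using (tendsto_one_div_add_atTop_nhds_zero_nat (𝕜 := ℝ)).const_mul 2
    · have h0 : Tendsto (fun n : ℕ => 2 * (1 / ((n:ℝ) + 1))) atTop (𝓝 0) := by
        simpa using (tendsto_one_div_add_atTop_nhds_zero_nat (𝕜 := ℝ)).const_mul 2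
      filter_upwards [h0.eventually (gt_mem_nhds ht0)] with n hn
      refine le_trans (le_of_eq ?_) (claim (1 / ((n:ℝ) + 1)) (by positivity) hn)
      refine setIntegral_congr_fun measurableSet_Ioc fun s hs => ?_
      have hs0 : 0 < s := lt_trans (by positivity) hs.1
      exact Real.norm_of_nonneg (hg_nonneg s hs0)
  have hI2 : IntegrableOn g (Ioo 0 1) := by
    refine (hI.union (hloc t0 1 ht0)).mono_set fun s hs => ?_
    rcases le_or_gt s t0 with h1 | h1
    · exact Or.inl ⟨hs.1, h1⟩
    · exact Or.inr ⟨h1, hs.2.le⟩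
  exact hI2.lintegral_lt_top.ne hg_int
end

section
/- Assume λ = 1 and p = 2. If a = lim_{s→∞} g(s) satisfies a ≥ λ₁, then problem (P) has no classical solution for any μ ≥ 0. -/
open Set MeasureTheory Filter Topology

/-- A classical solution of `−Δu = g(u) + λ |∇u|^p + μ f(x,u)` in `Ω`, `u > 0` in `Ω`,
`u = 0` on `∂Ω`. -/
def IsSolP {N : ℕ} (Ω : Set (EuclideanSpace ℝ (Fin N)))
    (f : EuclideanSpace ℝ (Fin N) → ℝ → ℝ) (g : ℝ → ℝ) (lam mu p : ℝ)
    (u : EuclideanSpace ℝ (Fin N) → ℝ) : Prop :=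
  ContDiffOn ℝ 2 u Ω ∧ ContinuousOn u (closure Ω) ∧
  (∀ x ∈ Ω, 0 < u x) ∧ (∀ x ∈ frontier Ω, u x = 0) ∧
  (∀ x ∈ Ω, -(lap u x) = g (u x) + lam * ‖gradient u x‖ ^ p + mu * f x (u x))

/-- Necessary second-order condition in one variable. -/
lemma deriv2_nonneg_of_isLocalMin {h : ℝ → ℝ} (hm : IsLocalMin h 0)
    (hc : ContinuousAt h 0) : 0 ≤ deriv (deriv h) 0 := by
  by_contra hneg
  push Not at hneg
  have h1 : deriv h 0 = 0 := hm.deriv_eq_zero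
  have hmax : IsLocalMax h 0 := by
    have := isLocalMax_of_deriv_deriv_neg hneg h1 hc
    exact this
  have hconst : h =ᶠ[𝓝 0] fun _ => h 0 := by
    filter_upwards [hm, hmax] with t h1 h2
    exact le_antisymm h2 h1
  have h3 := hconst.deriv.deriv_eq
  simp at h3
  linarith

/-- The Laplacian is nonnegative at an interior local minimum. -/
lemma lap_nonneg_of_isLocalMin {N : ℕ} {z : EuclideanSpace ℝ (Fin N) → ℝ}
    {x : EuclideanSpace ℝ (Fin N)} (hz : ContDiffAt ℝ 2 z x) (hm : IsLocalMin z x) :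
    0 ≤ lap z x := by
  unfold lap
  refine Finset.sum_nonneg fun i _ => ?_
  set e : EuclideanSpace ℝ (Fin N) := EuclideanSpace.single i 1
  have hl : ∀ t : ℝ, HasDerivAt (fun t : ℝ => x + t • e) e t := by
    intro t
    simpa using ((hasDerivAt_id t).smul_const e).const_add x
  have hlc : Tendsto (fun t : ℝ => x + t • e) (𝓝 0) (𝓝 x) := by
    have := (hl 0).continuousAt.tendsto
    simpa using this
  have hd : ∀ᶠ y in 𝓝 x, DifferentiableAt ℝ z y := by
    filter_upwards [hz.eventually (by simp)] with y hy
    exact hy.differentiableAt (by norm_num)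
  have hder : deriv (fun t : ℝ => z (x + t • e)) =ᶠ[𝓝 0] fun t => fderiv ℝ z (x + t • e) e := by
    filter_upwards [hlc.eventually hd] with t ht
    exact (ht.hasFDerivAt.comp_hasDerivAt t (hl t)).deriv
  have hd2 : DifferentiableAt ℝ (fun y => fderiv ℝ z y e) x :=
    ((hz.fderiv_right (m := 1) (by norm_num)).differentiableAt (by norm_num)).clm_apply
      (differentiableAt_const e)
  have key : deriv (deriv (fun t : ℝ => z (x + t • e))) 0
      = fderiv ℝ (fun y => fderiv ℝ z y e) x e := by
    rw [hder.deriv_eq]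
    have h0 : x + (0:ℝ) • e = x := by simp
    have : HasFDerivAt (fun y => fderiv ℝ z y e) (fderiv ℝ (fun y => fderiv ℝ z y e) x)
        (x + (0:ℝ) • e) := by rw [h0]; exact hd2.hasFDerivAt
    exact (this.comp_hasDerivAt (0:ℝ) (hl 0)).deriv
  rw [← key]
  apply deriv2_nonneg_of_isLocalMin
  · have := hlc.eventually hm
    filter_upwards [this] with t ht
    simpa using ht
  · have h0 : x + (0:ℝ) • e = x := by simp
    have hzc : ContinuousAt z (x + (0:ℝ) • e) := by rw [h0]; exact hz.continuousAt
    exact ContinuousAt.comp (f := fun t : ℝ => x + t • e) hzc (hl 0).continuousAt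

lemma norm_gradient_sq {N : ℕ} (u : EuclideanSpace ℝ (Fin N) → ℝ)
    (x : EuclideanSpace ℝ (Fin N)) :
    ‖gradient u x‖ ^ 2 = ∑ i : Fin N, (fderiv ℝ u x (EuclideanSpace.single i 1)) ^ 2 := by
  rw [EuclideanSpace.norm_sq_eq]
  refine Finset.sum_congr rfl fun i _ => ?_
  have : (gradient u x) i = fderiv ℝ u x (EuclideanSpace.single i 1) := by
    rw [← InnerProductSpace.toDual_symm_apply (𝕜 := ℝ)]
    rw [EuclideanSpace.inner_single_right]
    simp [gradient]
  rw [this, Real.norm_eq_abs, sq_abs]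

/-- Laplacian of `m (e^u - 1/2) - φ`. -/
lemma lap_comb {N : ℕ} {u φ : EuclideanSpace ℝ (Fin N) → ℝ}
    {x : EuclideanSpace ℝ (Fin N)} (hu : ContDiffAt ℝ 2 u x) (hφ : ContDiffAt ℝ 2 φ x) (m : ℝ) :
    lap (fun y => m * (Real.exp (u y) - 1 / 2) - φ y) x
      = m * (Real.exp (u x) * (lap u x + ‖gradient u x‖ ^ 2)) - lap φ x := by
  rw [norm_gradient_sq]
  unfold lap
  rw [← Finset.sum_add_distrib, Finset.mul_sum, Finset.mul_sum, ← Finset.sum_sub_distrib]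
  refine Finset.sum_congr rfl fun i _ => ?_
  set e : EuclideanSpace ℝ (Fin N) := EuclideanSpace.single i 1
  have hdu : ∀ᶠ y in 𝓝 x, DifferentiableAt ℝ u y := by
    filter_upwards [hu.eventually (by simp)] with y hy
    exact hy.differentiableAt (by norm_num)
  have hdφ : ∀ᶠ y in 𝓝 x, DifferentiableAt ℝ φ y := by
    filter_upwards [hφ.eventually (by simp)] with y hy
    exact hy.differentiableAt (by norm_num)
  have hev : (fun y => fderiv ℝ (fun y => m * (Real.exp (u y) - 1 / 2) - φ y) y e)
      =ᶠ[𝓝 x] fun y => m * (Real.exp (u y) * fderiv ℝ u y e) - fderiv ℝ φ y e := by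
    filter_upwards [hdu, hdφ] with y h1 h2
    have := (((h1.hasFDerivAt.exp).sub_const (1/2)).const_mul m).sub h2.hasFDerivAt
    rw [HasFDerivAt.fderiv (f := fun y => m * (Real.exp (u y) - 1 / 2) - φ y) this]
    simp
  rw [hev.fderiv_eq]
  have hu2 : DifferentiableAt ℝ (fun y => fderiv ℝ u y e) x :=
    ((hu.fderiv_right (m := 1) (by norm_num)).differentiableAt (by norm_num)).clm_apply
      (differentiableAt_const e)
  have hφ2 : DifferentiableAt ℝ (fun y => fderiv ℝ φ y e) x :=
    ((hφ.fderiv_right (m := 1) (by norm_num)).differentiableAt (by norm_num)).clm_apply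
      (differentiableAt_const e)
  have := ((((hdu.self_of_nhds).hasFDerivAt.exp).mul hu2.hasFDerivAt).const_mul m).sub
    hφ2.hasFDerivAt
  rw [HasFDerivAt.fderiv
    (f := fun y => m * (Real.exp (u y) * fderiv ℝ u y e) - fderiv ℝ φ y e) this]
  simp
  ring

/-- For `λ = 1`, `p = 2`: if `a = lim_{s→∞} g(s) ≥ λ₁`, then problem
`(P)` has no classical solution, for any `μ ≥ 0`. -/
theorem no_solution_quadratic_gradient_large_limit
    {N : ℕ} (hN : 2 ≤ N) (Ω : Set (EuclideanSpace ℝ (Fin N)))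
    (hΩopen : IsOpen Ω) (hΩbdd : Bornology.IsBounded Ω) (hΩne : Ω.Nonempty)
    (f : EuclideanSpace ℝ (Fin N) → ℝ → ℝ)
    (hf_holder : LocHolderOn (fun z : EuclideanSpace ℝ (Fin N) × ℝ => f z.1 z.2)
      ((closure Ω) ×ˢ Ici (0:ℝ)))
    (hf_nonneg : ∀ x ∈ closure Ω, ∀ s : ℝ, 0 ≤ s → 0 ≤ f x s)
    (hf_pos : ∀ x ∈ closure Ω, ∀ s : ℝ, 0 < s → 0 < f x s)
    (hf_mono : ∀ x ∈ closure Ω, ∀ s t : ℝ, 0 ≤ s → s ≤ t → f x s ≤ f x t)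
    (g : ℝ → ℝ)
    (hg_holder : LocHolderOn g (Ioi (0:ℝ)))
    (hg_pos : ∀ s : ℝ, 0 < s → 0 < g s)
    (hg_anti : ∀ s t : ℝ, 0 < s → s ≤ t → g t ≤ g s)
    (hg1 : Tendsto g (nhdsWithin 0 (Ioi 0)) atTop)
    (aL : ℝ) (haL : 0 ≤ aL) (hglim : Tendsto g atTop (nhds aL))
    (lam1 : ℝ) (hlam1 : 0 < lam1) (phi1 : EuclideanSpace ℝ (Fin N) → ℝ)
    (hphi1 : ContDiffOn ℝ 2 phi1 Ω ∧ ContinuousOn phi1 (closure Ω) ∧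
      (∀ x ∈ Ω, 0 < phi1 x) ∧ (∀ x ∈ frontier Ω, phi1 x = 0) ∧
      (∀ x ∈ Ω, -(lap phi1 x) = lam1 * phi1 x))
    (haL1 : lam1 ≤ aL) (mu : ℝ) (hmu : 0 ≤ mu) :
    ¬ ∃ u : EuclideanSpace ℝ (Fin N) → ℝ, IsSolP Ω f g 1 mu 2 u := by
  rintro ⟨u, hu2, huc, hupos, hu0, hueq⟩
  obtain ⟨hp2, hpc, hppos, hp0, hpeq⟩ := hphi1
  have hcl : ∀ x ∈ closure Ω, x ∈ Ω ∨ x ∈ frontier Ω := by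
    intro x hx
    by_cases h : x ∈ Ω
    · exact Or.inl h
    · right
      rw [hΩopen.frontier_eq]
      exact ⟨hx, h⟩
  have hunn : ∀ x ∈ closure Ω, 0 ≤ u x := by
    intro x hx
    rcases hcl x hx with h | h
    · exact (hupos x h).le
    · exact (hu0 x h).ge
  have hv : ∀ x ∈ closure Ω, 0 < Real.exp (u x) - 1 / 2 := by
    intro x hx
    have := Real.add_one_le_exp (u x)
    have := hunn x hx
    linarith
  have hcomp : IsCompact (closure Ω) := hΩbdd.isCompact_closure
  have hqc : ContinuousOn (fun x => phi1 x / (Real.exp (u x) - 1 / 2)) (closure Ω) :=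
    hpc.div ((Real.continuous_exp.comp_continuousOn huc).sub continuousOn_const)
      fun x hx => (hv x hx).ne'
  obtain ⟨x, hx, hmax⟩ := hcomp.exists_isMaxOn hΩne.closure hqc
  obtain ⟨y, hy⟩ := hΩne
  set m := phi1 x / (Real.exp (u x) - 1 / 2) with hm
  have hmpos : 0 < m := by
    have h1 : phi1 y / (Real.exp (u y) - 1 / 2) ≤ m := hmax (subset_closure hy)
    have h2 : 0 < phi1 y / (Real.exp (u y) - 1 / 2) :=
      div_pos (hppos y hy) (hv y (subset_closure hy))
    linarith
  have hxΩ : x ∈ Ω := by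
    rcases hcl x hx with h | h
    · exact h
    · rw [hp0 x h, zero_div] at hm
      linarith
  have hnh : Ω ∈ 𝓝 x := hΩopen.mem_nhds hxΩ
  have hua := hu2.contDiffAt hnh
  have hpa := hp2.contDiffAt hnh
  have hmx : m * (Real.exp (u x) - 1 / 2) = phi1 x := div_mul_cancel₀ _ (hv x hx).ne'
  have hmin : IsLocalMin (fun y => m * (Real.exp (u y) - 1 / 2) - phi1 y) x := by
    filter_upwards [hnh] with z hz
    have hz' := subset_closure hz
    have h1 : phi1 z / (Real.exp (u z) - 1 / 2) ≤ m := hmax hz'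
    rw [div_le_iff₀ (hv z hz')] at h1
    linarith
  have hlap := lap_nonneg_of_isLocalMin
    ((contDiffAt_const.mul (hua.exp.sub contDiffAt_const)).sub hpa) hmin
  rw [lap_comb hua hpa] at hlap
  have hg : lam1 ≤ g (u x) := by
    refine haL1.trans (le_of_tendsto hglim ?_)
    filter_upwards [eventually_ge_atTop (u x)] with t ht
    exact hg_anti _ _ (hupos x hxΩ) ht
  have hf : 0 ≤ mu * f x (u x) := mul_nonneg hmu (hf_nonneg x hx _ (hunn x hx))
  have h1 := hueq x hxΩ
  have h2 := hpeq x hxΩ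
  rw [Real.rpow_two] at h1
  have h3 : lap u x + ‖gradient u x‖ ^ 2 ≤ -lam1 := by linarith
  have h4 : m * (Real.exp (u x) * (lap u x + ‖gradient u x‖ ^ 2))
      ≤ m * (Real.exp (u x) * (-lam1)) := by
    gcongr
  have h5 : lap phi1 x = - (lam1 * (m * (Real.exp (u x) - 1 / 2))) := by
    rw [hmx]; linarith
  have h6 : 0 < lam1 * m := mul_pos hlam1 hmpos
  rw [h5] at hlap
  nlinarith
end
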